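/- arXiv:2411.04231 — 2 statements merged into one kernel-verified Lean document; each statement's English description precedes it below -/
import Mathlib

section
/- Let U be an open subset of EuclideanSpace ℝ (n+1), let F : EuclideanSpace ℝ (n+1) → ℝ be twice continuously differentiable on U with ∇F nonvanishing on U, and suppose F is isoparametric on U in the sense that there exist a continuously differentiable function φ₁ : ℝ → ℝ and a function φ₂ : ℝ → ℝ with ‖∇F(x)‖² = φ₁(F(x)) and ΔF(x) = φ₂(F(x)) for all x ∈ U, where ΔF is the trace of the second derivative of F. Define ξ(x) = ‖∇F(x)‖⁻¹ • ∇F(x). Then the divergence of ξ is constant on each level set of F: for all x, y ∈ U with F(x) = F(y), one has trace(fderiv ℝ ξ x) = trace(fderiv ℝ ξ y). -/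
open scoped Topology

/-- The divergence formula `div (c • G) = c * div G + ⟨∇c, G⟩` in terms of traces. -/
theorem HasFDerivAt.trace_fderiv_smul {E : Type*} [NormedAddCommGroup E] [NormedSpace ℝ E]
    [FiniteDimensional ℝ E] {c : E → ℝ} {c' : E →L[ℝ] ℝ} {G : E → E} {x : E}
    (hc : HasFDerivAt c c' x) (hG : DifferentiableAt ℝ G x) :
    LinearMap.trace ℝ E (fderiv ℝ (fun z => c z • G z) x).toLinearMap
      = c x * LinearMap.trace ℝ E (fderiv ℝ G x).toLinearMap + c' (G x) := by
  rw [(hc.fun_smul hG.hasFDerivAt).fderiv]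
  have h : (c x • fderiv ℝ G x + c'.smulRight (G x)).toLinearMap
      = c x • (fderiv ℝ G x).toLinearMap + c'.toLinearMap.smulRight (G x) := by
    ext; simp
  rw [h, map_add, map_smul, LinearMap.trace_smulRight]
  simp

/-- The gradient of a `C²` function is differentiable. -/
theorem ContDiffAt.differentiableAt_gradient {E : Type*} [NormedAddCommGroup E]
    [InnerProductSpace ℝ E] [CompleteSpace E] {f : E → ℝ} {x : E} (hf : ContDiffAt ℝ 2 f x) :
    DifferentiableAt ℝ (gradient f) x := by
  have h : DifferentiableAt ℝ (fderiv ℝ f) x :=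
    (hf.fderiv_right (m := 1) (by norm_num)).differentiableAt (by norm_num)
  exact (InnerProductSpace.toDual ℝ E).symm.toContinuousLinearEquiv.differentiableAt.comp x h

/-- The divergence of the normalized gradient of `F`, when `‖∇F‖²` is a function `φ` of `F`. -/
theorem trace_fderiv_normalized_gradient {E : Type*} [NormedAddCommGroup E]
    [InnerProductSpace ℝ E] [FiniteDimensional ℝ E] {F : E → ℝ} {φ : ℝ → ℝ} {x : E}
    (hF : ContDiffAt ℝ 2 F x) (hgrad : gradient F x ≠ 0)
    (hφ : DifferentiableAt ℝ φ (F x)) (h : ∀ᶠ z in 𝓝 x, ‖gradient F z‖ ^ 2 = φ (F z)) :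
    LinearMap.trace ℝ E (fderiv ℝ (fun z => ‖gradient F z‖⁻¹ • gradient F z) x).toLinearMap
      = (√(φ (F x)))⁻¹ * LinearMap.trace ℝ E (fderiv ℝ (gradient F) x).toLinearMap
        + deriv (fun t => (√(φ t))⁻¹) (F x) * φ (F x) := by
  have hpos : 0 < φ (F x) := by
    rw [← h.self_of_nhds]
    positivity
  have hψ : DifferentiableAt ℝ (fun t => (√(φ t))⁻¹) (F x) :=
    (hφ.sqrt hpos.ne').fun_inv (Real.sqrt_pos.2 hpos).ne'
  have hFx : DifferentiableAt ℝ F x := hF.differentiableAt (by norm_num)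
  have hev : (fun z => ‖gradient F z‖⁻¹ • gradient F z)
      =ᶠ[𝓝 x] fun z => (√(φ (F z)))⁻¹ • gradient F z := by
    filter_upwards [h] with z hz
    rw [← hz, Real.sqrt_sq (norm_nonneg _)]
  have hc : HasFDerivAt (fun z => (√(φ (F z)))⁻¹)
      (deriv (fun t => (√(φ t))⁻¹) (F x) • fderiv ℝ F x) x :=
    hψ.hasDerivAt.comp_hasFDerivAt x hFx.hasFDerivAt
  rw [hev.fderiv_eq, hc.trace_fderiv_smul hF.differentiableAt_gradient]
  simp [← inner_gradient_left, h.self_of_nhds]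

/-- Cartan's theorem (Euclidean case): every level hypersurface of an
isoparametric function has constant mean curvature. If `F` is `C²` on an open
set `U` with nonvanishing gradient, and both `‖∇F‖²` and the Laplacian
`ΔF = trace (fderiv ℝ (∇F))` are functions of `F` on `U`, then the divergence
of the unit normal field `ξ = ∇F/‖∇F‖` is constant on each level set of `F`. -/
theorem isoparametric_level_sets_constant_mean_curvature
    (n : ℕ) (U : Set (EuclideanSpace ℝ (Fin (n + 1)))) (hU : IsOpen U)
    (F : EuclideanSpace ℝ (Fin (n + 1)) → ℝ) (hF : ContDiffOn ℝ 2 F U)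
    (hgrad : ∀ x ∈ U, gradient F x ≠ 0)
    (φ₁ φ₂ : ℝ → ℝ) (hφ₁ : ContDiff ℝ 1 φ₁)
    (h1 : ∀ x ∈ U, ‖gradient F x‖ ^ 2 = φ₁ (F x))
    (h2 : ∀ x ∈ U, LinearMap.trace ℝ (EuclideanSpace ℝ (Fin (n + 1)))
        (fderiv ℝ (gradient F) x).toLinearMap = φ₂ (F x))
    (ξ : EuclideanSpace ℝ (Fin (n + 1)) → EuclideanSpace ℝ (Fin (n + 1)))
    (hξ : ∀ x, ξ x = ‖gradient F x‖⁻¹ • gradient F x) :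
    ∀ x ∈ U, ∀ y ∈ U, F x = F y →
      LinearMap.trace ℝ (EuclideanSpace ℝ (Fin (n + 1))) (fderiv ℝ ξ x).toLinearMap
        = LinearMap.trace ℝ (EuclideanSpace ℝ (Fin (n + 1))) (fderiv ℝ ξ y).toLinearMap := by
  obtain rfl : ξ = fun x => ‖gradient F x‖⁻¹ • gradient F x := funext hξ
  have key : ∀ x ∈ U, _ := fun x hx =>
    trace_fderiv_normalized_gradient (hF.contDiffAt (hU.mem_nhds hx)) (hgrad x hx)
      (hφ₁.differentiable (by norm_num) (F x)) (Filter.eventually_of_mem (hU.mem_nhds hx) h1)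
  intro x hx y hy hxy
  rw [key x hx, key y hy, h2 x hx, h2 y hy, hxy]
end

section
/- Let g ≥ 1 be a natural number and let F : EuclideanSpace ℝ (n+2) → ℝ be continuously differentiable, homogeneous of degree g (F(t • x) = t^g · F(x) for all t ∈ ℝ, x), and satisfy ‖∇F(x)‖² = g²·‖x‖^{2g−2} for all x. If the restriction of F to the unit sphere {x : ‖x‖ = 1} is not constant, then there exist unit vectors x and y with F(x) = 1 and F(y) = −1. -/
open scoped RealInnerProductSpace in
/-- Euler's relation for homogeneous functions. -/
theorem inner_gradient_self_of_homogeneous {E : Type*} [NormedAddCommGroup E]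
    [InnerProductSpace ℝ E] [CompleteSpace E] {F : E → ℝ} {g : ℕ} {x : E}
    (hF : DifferentiableAt ℝ F x) (hhom : ∀ t : ℝ, F (t • x) = t ^ g * F x) :
    ⟪gradient F x, x⟫ = g * F x := by
  have hline : HasDerivAt (fun t : ℝ => t • x) x 1 := by
    simpa using (hasDerivAt_id (1 : ℝ)).smul_const x
  have hchain : HasDerivAt (fun t : ℝ => F (t • x)) ⟪gradient F x, x⟫ 1 := by
    have hF' : HasFDerivAt F (InnerProductSpace.toDual ℝ E (gradient F x)) ((1 : ℝ) • x) := by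
      simpa using hF.hasGradientAt.hasFDerivAt
    exact hF'.comp_hasDerivAt (1 : ℝ) hline
  have hpow : HasDerivAt (fun t : ℝ => F (t • x)) (g * F x) 1 := by
    simp only [hhom]
    simpa using (hasDerivAt_pow g (1 : ℝ)).mul_const (F x)
  exact hchain.unique hpow

/-- At an extremum of `F` on the unit sphere, the gradient of `F` is radial. -/
theorem exists_gradient_eq_smul_of_isLocalExtrOn_sphere {E : Type*} [NormedAddCommGroup E]
    [InnerProductSpace ℝ E] [CompleteSpace E] {F : E → ℝ} {x : E}
    (hF : ContDiffAt ℝ 1 F x) (hx : ‖x‖ = 1)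
    (hext : IsLocalExtrOn F (Metric.sphere 0 1) x) :
    ∃ c : ℝ, gradient F x = c • x := by
  have hset : {z : E | ‖z‖ ^ 2 = ‖x‖ ^ 2} = Metric.sphere 0 1 := by
    ext z
    simp [hx, pow_eq_one_iff_of_nonneg]
  obtain ⟨a, b, hab, heq⟩ :=
    IsLocalExtrOn.exists_multipliers_of_hasStrictFDerivAt_1d (f := fun z : E => ‖z‖ ^ 2)
      (by rwa [hset]) (hasStrictFDerivAt_norm_sq x) (hF.hasStrictFDerivAt one_ne_zero)
  have hgrad : fderiv ℝ F x = InnerProductSpace.toDual ℝ E (gradient F x) := by simp [gradient]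
  have hvec : (2 * a) • x + b • gradient F x = 0 := by
    apply ext_inner_right ℝ
    intro v
    have hv := DFunLike.congr_fun heq v
    simp only [hgrad, add_apply, smul_apply,
      innerSL_apply_apply, InnerProductSpace.toDual_apply_apply, zero_apply,
      smul_eq_mul, nsmul_eq_mul, Nat.cast_ofNat] at hv
    simp only [inner_add_left, real_inner_smul_left, inner_zero_left]
    linarith
  have hb : b ≠ 0 := by
    rintro rfl
    have hx0 : x ≠ 0 := norm_ne_zero_iff.mp (by simp [hx])
    have ha : a = 0 := by simpa [hx0] using hvec
    exact hab (by simp [ha])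
  refine ⟨-(b⁻¹ * (2 * a)), ?_⟩
  rw [neg_smul, mul_smul, eq_neg_of_add_eq_zero_left hvec, smul_neg, inv_smul_smul₀ hb, neg_neg]

/-- At an extremum on the unit sphere, a solution of the first Cartan–Münzner equation takes
a value of square `1`. -/
theorem sq_eq_one_of_isLocalExtrOn_sphere {E : Type*} [NormedAddCommGroup E]
    [InnerProductSpace ℝ E] [CompleteSpace E] {F : E → ℝ} {g : ℕ} (hg : g ≠ 0) {x : E}
    (hF : ContDiffAt ℝ 1 F x) (hhom : ∀ t : ℝ, F (t • x) = t ^ g * F x)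
    (hCM : ‖gradient F x‖ ^ 2 = (g : ℝ) ^ 2 * ‖x‖ ^ (2 * g - 2)) (hx : ‖x‖ = 1)
    (hext : IsLocalExtrOn F (Metric.sphere 0 1) x) :
    F x ^ 2 = 1 := by
  obtain ⟨c, hc⟩ := exists_gradient_eq_smul_of_isLocalExtrOn_sphere hF hx hext
  have heuler := inner_gradient_self_of_homogeneous (hF.differentiableAt one_ne_zero) hhom
  rw [hc, real_inner_smul_left, real_inner_self_eq_norm_sq, hx, one_pow, mul_one] at heuler
  rw [hc, norm_smul, hx, one_pow, mul_one, mul_one, Real.norm_eq_abs, sq_abs, heuler,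
    mul_pow] at hCM
  exact (mul_eq_left₀ (by positivity)).mp hCM

/-- Münzner's result: the restriction to the unit sphere of a nonconstant
Cartan–Münzner polynomial attains both extreme values `1` and `−1`. If `F` is
`C¹`, homogeneous of degree `g ≥ 1`, satisfies `‖∇F(x)‖² = g²‖x‖^{2g−2}`, and
its restriction to the unit sphere is not constant, then there are unit
vectors `x`, `y` with `F x = 1` and `F y = −1`. -/
theorem cartan_muenzner_attains_extremes
    (n g : ℕ) (hg : 1 ≤ g)
    (F : EuclideanSpace ℝ (Fin (n + 2)) → ℝ) (hF : ContDiff ℝ 1 F)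
    (hhom : ∀ (t : ℝ) (x : EuclideanSpace ℝ (Fin (n + 2))), F (t • x) = t ^ g * F x)
    (hCM : ∀ x : EuclideanSpace ℝ (Fin (n + 2)),
      ‖gradient F x‖ ^ 2 = (g : ℝ) ^ 2 * ‖x‖ ^ (2 * g - 2))
    (hnc : ∃ x y : EuclideanSpace ℝ (Fin (n + 2)),
      ‖x‖ = 1 ∧ ‖y‖ = 1 ∧ F x ≠ F y) :
    ∃ x y : EuclideanSpace ℝ (Fin (n + 2)),
      ‖x‖ = 1 ∧ ‖y‖ = 1 ∧ F x = 1 ∧ F y = -1 := by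
  obtain ⟨u, v, hu, hv, huv⟩ := hnc
  have hcpt := isCompact_sphere (0 : EuclideanSpace ℝ (Fin (n + 2))) 1
  have hne : (Metric.sphere (0 : EuclideanSpace ℝ (Fin (n + 2))) 1).Nonempty := ⟨u, by simpa⟩
  obtain ⟨x, hxS, hx⟩ := hcpt.exists_isMaxOn hne hF.continuous.continuousOn
  obtain ⟨y, hyS, hy⟩ := hcpt.exists_isMinOn hne hF.continuous.continuousOn
  have hx1 : ‖x‖ = 1 := by simpa using hxS
  have hy1 : ‖y‖ = 1 := by simpa using hyS
  have hg0 : g ≠ 0 := by omega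
  have hFx := sq_eq_one_of_isLocalExtrOn_sphere hg0 hF.contDiffAt (fun t => hhom t x) (hCM x) hx1
    hx.localize.isExtr
  have hFy := sq_eq_one_of_isLocalExtrOn_sphere hg0 hF.contDiffAt (fun t => hhom t y) (hCM y) hy1
    hy.localize.isExtr
  have hyx : F y < F x := by
    have hux : F u ≤ F x := hx (by simpa using hu)
    have hvx : F v ≤ F x := hx (by simpa using hv)
    have hyu : F y ≤ F u := hy (by simpa using hu)
    have hyv : F y ≤ F v := hy (by simpa using hv)
    by_contra! h
    exact huv (by linarith)
  refine ⟨x, y, hx1, hy1, ?_⟩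
  rcases sq_eq_one_iff.mp hFx with h | h <;> rcases sq_eq_one_iff.mp hFy with h' | h' <;>
    constructor <;> linarith
end
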